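/- For every double cone D ⊂ ℝ⁴, the intersection of all wedges containing D equals D: ⋂{W ∈ 𝒲 : D ⊆ W} = D. -/

import Mathlib

noncomputable section

open Real

/-- The Minkowski bilinear form on `ℝ⁴`. -/
def mink (x y : Fin 4 → ℝ) : ℝ := x 0 * y 0 - x 1 * y 1 - x 2 * y 2 - x 3 * y 3

/-- The right wedge `W_r = {x : |x⁰| < x¹}`. -/
def rightWedge : Set (Fin 4 → ℝ) := {x | |x 0| < x 1}

/-- The proper orthochronous Lorentz group `𝓛₊↑`, as a set of real 4×4 matrices. -/
def LorentzPO : Set (Matrix (Fin 4) (Fin 4) ℝ) :=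
  {Λ | (∀ x y, mink (Λ.mulVec x) (Λ.mulVec y) = mink x y) ∧ Λ.det = 1 ∧ 0 < Λ 0 0}

/-- The set of wedges `𝒲`: images of the right wedge under proper orthochronous
Poincaré transformations. -/
def WedgeSet : Set (Set (Fin 4 → ℝ)) :=
  {S | ∃ (Λ : Matrix (Fin 4) (Fin 4) ℝ) (a : Fin 4 → ℝ), Λ ∈ LorentzPO ∧
    S = (fun x => Λ.mulVec x + a) '' rightWedge}

/-- The causal complement of a set: the interior of the set of points spacelike to it. -/
def causalCompl (S : Set (Fin 4 → ℝ)) : Set (Fin 4 → ℝ) :=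
  interior {x | ∀ y ∈ S, mink (x - y) (x - y) < 0}

/-- The open forward light cone. -/
def fwdCone : Set (Fin 4 → ℝ) := {x | 0 < x 0 ∧ 0 < mink x x}

/-- A double cone is a set of the form `(a + V⁺) ∩ (b − V⁺)` with `b − a ∈ V⁺`. -/
def IsDoubleCone (D : Set (Fin 4 → ℝ)) : Prop :=
  ∃ a b : Fin 4 → ℝ, b - a ∈ fwdCone ∧ D = {x | x - a ∈ fwdCone ∧ b - x ∈ fwdCone}

/-- The boost group `Λ_{W_r}(t)` of the right wedge. -/
def boost (t : ℝ) : Matrix (Fin 4) (Fin 4) ℝ :=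
  Matrix.of fun i j =>
    if i = 0 ∧ j = 0 then Real.cosh (2 * π * t)
    else if i = 0 ∧ j = 1 then -Real.sinh (2 * π * t)
    else if i = 1 ∧ j = 0 then -Real.sinh (2 * π * t)
    else if i = 1 ∧ j = 1 then Real.cosh (2 * π * t)
    else if i = j then 1 else 0

lemma wedge_mem (p q r u v : ℝ) (h : p ^ 2 + q ^ 2 + r ^ 2 = 1) :
    {z : Fin 4 → ℝ | z 0 - (p * z 1 + q * z 2 + r * z 3) < u ∧
      v < z 0 + (p * z 1 + q * z 2 + r * z 3)} ∈ WedgeSet := by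
  obtain ⟨M, hM, h0, h1⟩ : ∃ M : Matrix (Fin 4) (Fin 4) ℝ, M ∈ LorentzPO ∧
      (∀ x : Fin 4 → ℝ, M.mulVec x 0 = x 0) ∧
      (∀ x : Fin 4 → ℝ, p * M.mulVec x 1 + q * M.mulVec x 2 + r * M.mulVec x 3 = x 1) := by
    by_cases hp : 1 + p = 0
    · have hp' : p = -1 := by linarith
      subst hp'
      have hq : q = 0 := by nlinarith [sq_nonneg q, sq_nonneg r]
      have hr : r = 0 := by nlinarith [sq_nonneg q, sq_nonneg r]
      subst hq hr
      refine ⟨!![1, 0, 0, 0; 0, -1, 0, 0; 0, 0, -1, 0; 0, 0, 0, 1], ⟨?_, ?_, ?_⟩, ?_, ?_⟩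
      · intro x y
        simp [mink, Matrix.mulVec, dotProduct, Fin.sum_univ_succ]
      · simp [Matrix.det_succ_row_zero, Fin.sum_univ_succ, Fin.succAbove]
      · simp
      · intro x
        simp [Matrix.mulVec, dotProduct, Fin.sum_univ_succ]
      · intro x
        simp [Matrix.mulVec, dotProduct, Fin.sum_univ_succ]
    · obtain ⟨k, hk⟩ : ∃ k, k * (1 + p) = 1 := ⟨(1 + p)⁻¹, inv_mul_cancel₀ hp⟩
      have hk2 : k * (q ^ 2 + r ^ 2) = 1 - p := by
        linear_combination k * h + (1 - p) * hk
      have hmul : ∀ x : Fin 4 → ℝ, (!![1, 0, 0, 0; 0, p, -q, -r; 0, q, 1 - k * q ^ 2, -(k * q * r);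
          0, r, -(k * q * r), 1 - k * r ^ 2] : Matrix (Fin 4) (Fin 4) ℝ).mulVec x =
          ![x 0, p * x 1 - q * x 2 - r * x 3,
            q * x 1 + (1 - k * q ^ 2) * x 2 - k * q * r * x 3,
            r * x 1 - k * q * r * x 2 + (1 - k * r ^ 2) * x 3] := by
        intro x
        ext i
        fin_cases i <;> simp [Matrix.mulVec, dotProduct, Fin.sum_univ_succ] <;> ring
      have e22 : q ^ 2 + (1 - k * q ^ 2) ^ 2 + (k * q * r) ^ 2 = 1 := by
        linear_combination k * q ^ 2 * hk2 - q ^ 2 * hk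
      have e33 : r ^ 2 + (1 - k * r ^ 2) ^ 2 + (k * q * r) ^ 2 = 1 := by
        linear_combination k * r ^ 2 * hk2 - r ^ 2 * hk
      have e23 : q * r - (1 - k * q ^ 2) * (k * q * r) - (1 - k * r ^ 2) * (k * q * r) = 0 := by
        linear_combination k * q * r * hk2 - q * r * hk
      have e12 : -(p * q) + q * (1 - k * q ^ 2) - r * (k * q * r) = 0 := by
        linear_combination -q * hk2
      have e13 : -(p * r) - q * (k * q * r) + r * (1 - k * r ^ 2) = 0 := by
        linear_combination -r * hk2
      refine ⟨!![1, 0, 0, 0; 0, p, -q, -r; 0, q, 1 - k * q ^ 2, -(k * q * r);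
          0, r, -(k * q * r), 1 - k * r ^ 2], ⟨?_, ?_, ?_⟩, ?_, ?_⟩
      · intro x y
        rw [hmul, hmul]
        simp [mink]
        linear_combination (-(x 1 * y 1)) * h - x 2 * y 2 * e22 - x 3 * y 3 * e33
          - (x 2 * y 3 + x 3 * y 2) * e23 - (x 1 * y 2 + x 2 * y 1) * e12
          - (x 1 * y 3 + x 3 * y 1) * e13
      · simp [Matrix.det_succ_row_zero, Fin.sum_univ_succ, Fin.succAbove]
        linear_combination h - p * hk2
      · simp
      · intro x
        rw [hmul]; simp
      · intro x
        rw [hmul]; simp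
        linear_combination x 1 * h + x 2 * e12 + x 3 * e13
  refine ⟨M, ![(u + v) / 2, (v - u) / 2 * p, (v - u) / 2 * q, (v - u) / 2 * r], hM, ?_⟩
  ext z
  simp only [Set.mem_setOf_eq, Set.mem_image, rightWedge]
  have key : ∀ x : Fin 4 → ℝ, M.mulVec x +
      ![(u + v) / 2, (v - u) / 2 * p, (v - u) / 2 * q, (v - u) / 2 * r] = z →
      (z 0 = x 0 + (u + v) / 2 ∧ p * z 1 + q * z 2 + r * z 3 = x 1 + (v - u) / 2) := by
    rintro x rfl
    have := h1 x
    simp [h0]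
    linear_combination this + (v - u) / 2 * h
  constructor
  · rintro ⟨ha, hb⟩
    set c : Fin 4 → ℝ := ![(u + v) / 2, (v - u) / 2 * p, (v - u) / 2 * q, (v - u) / 2 * r]
    have hx : M.mulVec (M⁻¹.mulVec (z - c)) + c = z := by
      rw [Matrix.mulVec_mulVec, Matrix.mul_nonsing_inv _ (by rw [hM.2.1]; exact isUnit_one)]
      simp
    refine ⟨_, ?_, hx⟩
    obtain ⟨k0, k1⟩ := key _ hx
    rw [abs_lt]
    constructor <;> linarith
  · rintro ⟨x, hx, hz⟩
    obtain ⟨k0, k1⟩ := key _ hz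
    rw [abs_lt] at hx
    constructor <;> linarith [hx.1, hx.2]

lemma fwd_lt {y : Fin 4 → ℝ} (hy : y ∈ fwdCone) {p q r : ℝ} (h : p ^ 2 + q ^ 2 + r ^ 2 = 1) :
    |p * y 1 + q * y 2 + r * y 3| < y 0 := by
  obtain ⟨h0, h1⟩ := hy
  apply abs_lt_of_sq_lt_sq _ h0.le
  have e : (p * y 1 + q * y 2 + r * y 3) ^ 2 =
      (p ^ 2 + q ^ 2 + r ^ 2) * (y 1 ^ 2 + y 2 ^ 2 + y 3 ^ 2)
      - (p * y 2 - q * y 1) ^ 2 - (p * y 3 - r * y 1) ^ 2 - (q * y 3 - r * y 2) ^ 2 := by ring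
  rw [e, h]
  unfold mink at h1
  nlinarith [sq_nonneg (p * y 2 - q * y 1), sq_nonneg (p * y 3 - r * y 1),
    sq_nonneg (q * y 3 - r * y 2)]

lemma exists_dir {y : Fin 4 → ℝ} (hy : y ∉ fwdCone) : ∃ p q r : ℝ, p ^ 2 + q ^ 2 + r ^ 2 = 1 ∧
    y 0 + (p * y 1 + q * y 2 + r * y 3) ≤ 0 := by
  have hn : 0 ≤ y 1 ^ 2 + y 2 ^ 2 + y 3 ^ 2 := by positivity
  set s := Real.sqrt (y 1 ^ 2 + y 2 ^ 2 + y 3 ^ 2) with hs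
  have hs2 : s ^ 2 = y 1 ^ 2 + y 2 ^ 2 + y 3 ^ 2 := Real.sq_sqrt hn
  have hs0 : 0 ≤ s := Real.sqrt_nonneg _
  have hle : y 0 ≤ s := by
    by_contra hc
    push Not at hc
    refine hy ⟨by linarith, ?_⟩
    unfold mink
    nlinarith
  rcases hs0.eq_or_lt with h | h
  · rw [← h] at hs2 hle
    have h1 : y 1 = 0 := by nlinarith [sq_nonneg (y 1), sq_nonneg (y 2), sq_nonneg (y 3)]
    exact ⟨1, 0, 0, by norm_num, by rw [h1]; linarith⟩
  · refine ⟨-(y 1 / s), -(y 2 / s), -(y 3 / s), ?_, ?_⟩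
    · field_simp
      linarith
    · have : -(y 1 / s) * y 1 + -(y 2 / s) * y 2 + -(y 3 / s) * y 3 = -s := by
        field_simp
        linarith
      linarith

/-- Every double cone `D ⊂ ℝ⁴` is the intersection of all wedges
containing it. -/
theorem double_cone_eq_iInter_wedges
    (D : Set (Fin 4 → ℝ)) (hD : IsDoubleCone D) :
    ⋂₀ {W | W ∈ WedgeSet ∧ D ⊆ W} = D := by
  obtain ⟨a, b, -, rfl⟩ := hD
  apply Set.Subset.antisymm
  · intro x hx
    by_contra hxD
    obtain ⟨p, q, r, h, hcase⟩ : ∃ p q r : ℝ, p ^ 2 + q ^ 2 + r ^ 2 = 1 ∧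
        ((x - a) 0 + (p * (x - a) 1 + q * (x - a) 2 + r * (x - a) 3) ≤ 0 ∨
         (b - x) 0 - (p * (b - x) 1 + q * (b - x) 2 + r * (b - x) 3) ≤ 0) := by
      by_cases h1 : x - a ∈ fwdCone
      · have h2 : b - x ∉ fwdCone := fun h2 => hxD ⟨h1, h2⟩
        obtain ⟨p, q, r, h, hh⟩ := exists_dir h2
        exact ⟨-p, -q, -r, by linarith, Or.inr (by linarith)⟩
      · obtain ⟨p, q, r, h, hh⟩ := exists_dir h1
        exact ⟨p, q, r, h, Or.inl hh⟩
    have hW := hx _ ⟨wedge_mem p q r (b 0 - (p * b 1 + q * b 2 + r * b 3))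
      (a 0 + (p * a 1 + q * a 2 + r * a 3)) h, by
        rintro z ⟨hz1, hz2⟩
        have k1 := abs_lt.1 (fwd_lt hz1 h)
        have k2 := abs_lt.1 (fwd_lt hz2 h)
        simp only [Pi.sub_apply] at k1 k2
        constructor <;> linarith [k1.1, k1.2, k2.1, k2.2]⟩
    obtain ⟨w1, w2⟩ := hW
    simp only [Pi.sub_apply] at hcase
    rcases hcase with hc | hc <;> linarith
  · intro x hx W hW
    exact hW.2 hx
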